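/- For every x_o ∈ closure(ω_o), every h ∈ (0,h_o], and every initial data (u₀,u₁) ∈ (H²(Ω)∩H₀¹(Ω)) × H₀¹(Ω), the solution u of the free wave equation satisfies ∫_{Ω×ℝ} χ(x) |a_o(x,t) ∂_t u(x,t)|² dx dt ≤ 2 ∫_{Ω×ℝ} a_o(x,t/√2) φ(x,t/√2) |u(x,t)|² dx dt + | ∫_{Ω×ℝ} a_o(x,t) φ(x,t) ∂_t²u(x,t) u(x,t) dx dt |. -/

import Mathlib

open MeasureTheory Set

noncomputable section

local notation "R3" => EuclideanSpace ℝ (Fin 3)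

def sdir (i : Fin 3) : R3 := EuclideanSpace.single i 1

/-- Laplacian of a real-valued function on `ℝ³`. -/
def lapR (f : R3 → ℝ) (x : R3) : ℝ :=
  ∑ i : Fin 3, lineDeriv ℝ (fun y => lineDeriv ℝ f y (sdir i)) x (sdir i)

/-- `a_o(x,t) = a(x−x_o,t,0) = e^{-|x-x_o|²/(4h)} e^{-t²/4}`. -/
def aO (h : ℝ) (x_o x : R3) (t : ℝ) : ℝ :=
  Real.exp (-‖x - x_o‖^2 / (4*h)) * Real.exp (-t^2 / 4)

theorem div_aux (Ω : Set R3) (hΩopen : IsOpen Ω) (hΩbdd : Bornology.IsBounded Ω)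
    (f : R3 → ℝ) (hf : ContDiff ℝ 1 f) (hfs : HasCompactSupport f)
    (hf0 : ∀ x ∈ frontier Ω, f x = 0) (v : R3) :
    ∫ x in Ω, fderiv ℝ f x v = 0 := by
  have hne : Ω ≠ univ := by
    rintro rfl
    exact NormedSpace.unbounded_univ ℝ R3 hΩbdd
  have hcne : (Ωᶜ).Nonempty := nonempty_compl.2 hne
  have hcK : IsCompact (closure Ω) := hΩbdd.isCompact_closure
  have hfin : volume Ω ≠ ⊤ := hΩbdd.measure_lt_top.ne
  obtain ⟨L, hL⟩ := ContDiff.lipschitzWith_of_hasCompactSupport hfs hf one_ne_zero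
  have hfd : ∀ x, lineDeriv ℝ f x v = fderiv ℝ f x v := fun x =>
    ((hf.differentiable one_ne_zero) x).lineDeriv_eq_fderiv
  have hfbound : ∀ x ∈ Ω, |f x| ≤ L * Metric.infDist x Ωᶜ := by
    intro x hx
    obtain ⟨y, hy, hd⟩ := exists_mem_frontier_infDist_compl_eq_dist hx hne
    have := hL.dist_le_mul x y
    rw [hf0 y hy, Real.dist_eq, sub_zero] at this
    rwa [hd]
  let g : ℕ → R3 → ℝ := fun n x => min ((n:ℝ) * Metric.infDist x Ωᶜ) 1
  have hgl : ∀ n : ℕ, LipschitzWith (n : NNReal) (g n) := by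
    intro n
    have h1 : LipschitzWith ((n : NNReal) * 1) (fun x : R3 => (n:ℝ) * Metric.infDist x Ωᶜ) := by
      have := (lipschitzWith_smul (n:ℝ)).comp (Metric.lipschitz_infDist_pt (Ωᶜ))
      simpa [Function.comp_def] using this
    rw [mul_one] at h1
    exact h1.min_const 1
  have hg0 : ∀ n x, x ∉ Ω → g n x = 0 := by
    intro n x hx
    have : Metric.infDist x Ωᶜ = 0 := Metric.infDist_zero_of_mem hx
    simp [g, this]
  have hgnn : ∀ n x, 0 ≤ g n x := fun n x =>
    le_min (mul_nonneg (Nat.cast_nonneg _) Metric.infDist_nonneg) zero_le_one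
  have hgle : ∀ n x, g n x ≤ 1 := fun n x => min_le_right _ _
  have hgs : ∀ n, HasCompactSupport (g n) := fun n =>
    HasCompactSupport.intro hcK (fun x hx => hg0 n x (fun h => hx (subset_closure h)))
  have hpos : ∀ x ∈ Ω, 0 < Metric.infDist x Ωᶜ := fun x hx =>
    (hΩopen.isClosed_compl.notMem_iff_infDist_pos hcne).1 (by simpa using hx)
  have hgd1 : ∀ (n : ℕ) x w, (1:ℝ) ≤ n * Metric.infDist x Ωᶜ → lineDeriv ℝ (g n) x w = 0 := by
    intro n x w h1
    have : IsLocalMax (fun s : ℝ => g n (x + s • w)) 0 := by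
      refine Filter.Eventually.of_forall fun s => ?_
      have : g n (x + (0:ℝ) • w) = 1 := by simp [g, h1]
      simp only [this]
      exact hgle _ _
    exact this.deriv_eq_zero
  have hgd0 : ∀ n x w, x ∉ Ω → lineDeriv ℝ (g n) x w = 0 := by
    intro n x w h1
    have : IsLocalMin (fun s : ℝ => g n (x + s • w)) 0 := by
      refine Filter.Eventually.of_forall fun s => ?_
      have : g n (x + (0:ℝ) • w) = 0 := by simp [hg0 n x h1]
      simp only [this]
      exact hgnn _ _
    exact this.deriv_eq_zero
  have hev : ∀ x ∈ Ω, ∀ᶠ n : ℕ in Filter.atTop, (1:ℝ) ≤ n * Metric.infDist x Ωᶜ := by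
    intro x hx
    exact (Filter.Tendsto.atTop_mul_const (hpos x hx) tendsto_natCast_atTop_atTop).eventually_ge_atTop 1
  have key : ∀ n, ∫ x in Ω, fderiv ℝ f x v * g n x = ∫ x in Ω, lineDeriv ℝ (g n) x (-v) * f x := by
    intro n
    have := LipschitzWith.integral_lineDeriv_mul_eq (μ := volume) hL (hgl n) (hgs n) v
    rw [setIntegral_eq_integral_of_forall_compl_eq_zero (fun x hx => by rw [hg0 n x hx, mul_zero]),
      setIntegral_eq_integral_of_forall_compl_eq_zero
        (fun x hx => by rw [hgd0 n x _ hx, zero_mul]), ← this]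
    simp_rw [hfd]
  have hcf : Continuous (fun x => fderiv ℝ f x v) :=
    (hf.continuous_fderiv one_ne_zero).clm_apply continuous_const
  have t1 : Filter.Tendsto (fun n => ∫ x in Ω, fderiv ℝ f x v * g n x) Filter.atTop
      (nhds (∫ x in Ω, fderiv ℝ f x v)) := by
    refine tendsto_integral_of_dominated_convergence (fun x => ‖fderiv ℝ f x v‖) ?_ ?_ ?_ ?_
    · intro n
      exact (hcf.mul (hgl n).continuous).aestronglyMeasurable
    · exact ((hcf.norm.continuousOn.integrableOn_compact hcK).mono_set subset_closure)
    · intro n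
      refine Filter.Eventually.of_forall fun x => ?_
      rw [norm_mul, Real.norm_of_nonneg (hgnn n x)]
      exact mul_le_of_le_one_right (norm_nonneg _) (hgle n x)
    · refine (ae_restrict_mem hΩopen.measurableSet).mono fun x hx => ?_
      refine tendsto_const_nhds.congr' ?_
      filter_upwards [hev x hx] with n hn
      simp [g, hn]
  have t2 : Filter.Tendsto (fun n => ∫ x in Ω, lineDeriv ℝ (g n) x (-v) * f x) Filter.atTop
      (nhds (∫ x in Ω, (0:ℝ))) := by
    refine tendsto_integral_of_dominated_convergence (fun x => ‖v‖ * L) ?_ ?_ ?_ ?_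
    · intro n
      exact ((measurable_lineDeriv (hgl n).continuous).aestronglyMeasurable).mul
        hf.continuous.aestronglyMeasurable
    · exact integrableOn_const hfin
    · intro n
      refine (ae_restrict_mem hΩopen.measurableSet).mono fun x hx => ?_
      by_cases h1 : (1:ℝ) ≤ n * Metric.infDist x Ωᶜ
      · rw [hgd1 n x _ h1, zero_mul, norm_zero]; positivity
      · push Not at h1
        rw [norm_mul]
        have a1 := norm_lineDeriv_le_of_lipschitz ℝ (hgl n) (x₀ := x) (v := -v)
        have a2 := hfbound x hx
        rw [norm_neg] at a1
        simp only [NNReal.coe_natCast] at a1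
        calc ‖lineDeriv ℝ (g n) x (-v)‖ * ‖f x‖ ≤ (n * ‖v‖) * (L * Metric.infDist x Ωᶜ) := by
              exact mul_le_mul a1 a2 (abs_nonneg _) (by positivity)
          _ = ‖v‖ * L * (n * Metric.infDist x Ωᶜ) := by ring
          _ ≤ ‖v‖ * L * 1 := by gcongr
          _ = _ := mul_one _
    · refine (ae_restrict_mem hΩopen.measurableSet).mono fun x hx => ?_
      refine tendsto_const_nhds.congr' ?_
      filter_upwards [hev x hx] with n hn
      rw [hgd1 n x _ hn, zero_mul]
  simp_rw [key] at t1
  simpa using tendsto_nhds_unique t1 t2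

theorem div_lemma (Ω : Set R3) (hΩopen : IsOpen Ω) (hΩbdd : Bornology.IsBounded Ω)
    (f : R3 → ℝ) (hf : ContDiff ℝ 1 f)
    (hf0 : ∀ x ∈ frontier Ω, f x = 0) (v : R3) :
    ∫ x in Ω, fderiv ℝ f x v = 0 := by
  obtain ⟨R, hR⟩ := hΩbdd.subset_closedBall (0 : R3)
  let b : ContDiffBump (0 : R3) := ⟨max R 1, max R 1 + 1, by positivity, by linarith⟩
  have hb1 : ∀ x ∈ Ω, b x = 1 := fun x hx =>
    b.one_of_mem_closedBall (Metric.closedBall_subset_closedBall (le_max_left _ _) (hR hx))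
  have := div_aux Ω hΩopen hΩbdd (fun x => b x * f x) (b.contDiff.mul hf)
    (b.hasCompactSupport.mul_right) (fun x hx => by simp [hf0 x hx]) v
  rw [← this]
  refine setIntegral_congr_fun hΩopen.measurableSet fun x hx => ?_
  have : (fun x => b x * f x) =ᶠ[nhds x] f := by
    filter_upwards [hΩopen.mem_nhds hx] with y hy
    simp [hb1 y hy]
  simp only [this.fderiv_eq]

/-- directional derivative -/
def PD (w : R3 × ℝ) (F : R3 × ℝ → ℝ) (p : R3 × ℝ) : ℝ := fderiv ℝ F p w

def tau : R3 × ℝ := (0, 1)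

def ei (i : Fin 3) : R3 × ℝ := (sdir i, 0)

theorem PD_contDiff {n m : ℕ∞} (h : (m : WithTop ℕ∞) + 1 ≤ n) {F : R3 × ℝ → ℝ} (hF : ContDiff ℝ n F)
    (w : R3 × ℝ) : ContDiff ℝ m (PD w F) :=
  (hF.fderiv_right h).clm_apply contDiff_const

theorem PD_cont {F : R3 × ℝ → ℝ} (hF : ContDiff ℝ 1 F) (w : R3 × ℝ) : Continuous (PD w F) :=
  (hF.continuous_fderiv one_ne_zero).clm_apply continuous_const

theorem PD_c1 {F : R3 × ℝ → ℝ} (hF : ContDiff ℝ 2 F) (w : R3 × ℝ) : ContDiff ℝ 1 (PD w F) :=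
  (hF.fderiv_right (m := 1) (by norm_num)).clm_apply contDiff_const

theorem PD_symm {F : R3 × ℝ → ℝ} (hF : ContDiff ℝ 2 F) (v w : R3 × ℝ) (p : R3 × ℝ) :
    PD v (PD w F) p = PD w (PD v F) p := by
  have hd : DifferentiableAt ℝ (fderiv ℝ F) p :=
    ((hF.fderiv_right (m := 1) (by norm_num)).differentiable one_ne_zero) p
  have e : ∀ a b, PD a (PD b F) p = fderiv ℝ (fderiv ℝ F) p a b := by
    intro a b
    unfold PD
    rw [fderiv_clm_apply hd (differentiableAt_const b)]
    simp
  rw [e, e]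
  exact (hF.contDiffAt.isSymmSndFDerivAt (by simp)).eq v w

theorem PD_mul {F G : R3 × ℝ → ℝ} (hF : ContDiff ℝ 1 F) (hG : ContDiff ℝ 1 G) (w p : R3 × ℝ) :
    PD w (fun q => F q * G q) p = F p * PD w G p + G p * PD w F p := by
  unfold PD
  rw [fderiv_fun_mul ((hF.differentiable one_ne_zero) p) ((hG.differentiable one_ne_zero) p)]
  simp

theorem PD_hasDeriv_t {F : R3 × ℝ → ℝ} (hF : ContDiff ℝ 1 F) (x : R3) (t : ℝ) :
    HasDerivAt (fun s => F (x, s)) (PD tau F (x, t)) t := by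
  have h1 : HasDerivAt (fun s : ℝ => (x, s)) ((0 : R3), (1:ℝ)) t :=
    (hasDerivAt_const t x).prodMk (hasDerivAt_id t)
  exact ((hF.differentiable one_ne_zero) (x, t)).hasFDerivAt.comp_hasDerivAt t h1

theorem PD_slice {F : R3 × ℝ → ℝ} (hF : ContDiff ℝ 1 F) (x v : R3) (t : ℝ) :
    fderiv ℝ (fun y => F (y, t)) x v = PD (v, 0) F (x, t) := by
  have h1 : HasFDerivAt (fun y : R3 => (y, t)) (ContinuousLinearMap.inl ℝ R3 ℝ) x :=
    hasFDerivAt_prodMk_left x t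
  have h2 := ((hF.differentiable one_ne_zero) (x, t)).hasFDerivAt.comp x h1
  have h3 : fderiv ℝ (fun y => F (y, t)) x = _ := h2.fderiv
  rw [h3]
  simp [PD]

theorem slice_contDiff {n : WithTop ℕ∞} {F : R3 × ℝ → ℝ} (hF : ContDiff ℝ n F) (t : ℝ) :
    ContDiff ℝ n (fun y => F (y, t)) := hF.comp (contDiff_prodMk_left t)

theorem PD_line {F : R3 × ℝ → ℝ} (hF : ContDiff ℝ 1 F) (x v : R3) (t : ℝ) :
    lineDeriv ℝ (fun y => F (y, t)) x v = PD (v, 0) F (x, t) := by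
  rw [← PD_slice hF]
  exact (((slice_contDiff hF t).differentiable one_ne_zero) x).lineDeriv_eq_fderiv

theorem intOn {Ω : Set R3} (hΩbdd : Bornology.IsBounded Ω) {f : R3 → ℝ} (hf : Continuous f) :
    IntegrableOn f Ω :=
  (hf.continuousOn.integrableOn_compact hΩbdd.isCompact_closure).mono_set subset_closure

theorem bddBox {Ω : Set R3} (hΩbdd : Bornology.IsBounded Ω) {G : R3 × ℝ → ℝ} (hG : Continuous G)
    (t : ℝ) : ∃ C, ∀ x ∈ Ω, ∀ s ∈ Icc (t-1) (t+1), ‖G (x, s)‖ ≤ C := by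
  obtain ⟨C, hC⟩ := (hΩbdd.isCompact_closure.prod (isCompact_Icc (a := t-1) (b := t+1))).exists_bound_of_continuousOn
    hG.continuousOn
  exact ⟨C, fun x hx s hs => hC (x, s) ⟨subset_closure hx, hs⟩⟩

theorem deriv_int {Ω : Set R3} (hΩopen : IsOpen Ω) (hΩbdd : Bornology.IsBounded Ω)
    {G : R3 × ℝ → ℝ} (hG : ContDiff ℝ 1 G) (t : ℝ) :
    HasDerivAt (fun t => ∫ x in Ω, G (x, t)) (∫ x in Ω, PD tau G (x, t)) t := by
  obtain ⟨C, hC⟩ := bddBox hΩbdd (PD_cont hG tau) t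
  have hcs : ∀ s, Continuous fun x => G (x, s) := fun s => (slice_contDiff hG s).continuous
  refine (hasDerivAt_integral_of_dominated_loc_of_deriv_le (s := Icc (t-1) (t+1))
    (F := fun s x => G (x, s)) (F' := fun s x => PD tau G (x, s)) (bound := fun _ => C)
    (Icc_mem_nhds (by linarith) (by linarith)) ?_ ?_ ?_ ?_ ?_ ?_).2
  · exact Filter.Eventually.of_forall fun s => (hcs s).aestronglyMeasurable
  · exact intOn hΩbdd (hcs t)
  · exact ((PD_cont hG tau).comp (by fun_prop : Continuous fun x : R3 => (x, t))).aestronglyMeasurable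
  · exact (ae_restrict_mem hΩopen.measurableSet).mono fun x hx s hs => hC x hx s hs
  · exact integrableOn_const hΩbdd.measure_lt_top.ne
  · exact Filter.Eventually.of_forall fun x s hs => PD_hasDeriv_t hG x s

def En (Ω : Set R3) (F : R3 × ℝ → ℝ) (t : ℝ) : ℝ :=
  (∫ x in Ω, (PD tau F (x, t))^2) + ∑ i : Fin 3, ∫ x in Ω, (PD (ei i) F (x, t))^2

structure Sol (Ω : Set R3) (F : R3 × ℝ → ℝ) : Prop where
  reg : ContDiff ℝ 2 F
  bc : ∀ x ∈ frontier Ω, ∀ t : ℝ, F (x, t) = 0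
  pde : ∀ x ∈ Ω, ∀ t : ℝ, PD tau (PD tau F) (x, t) = ∑ i : Fin 3, PD (ei i) (PD (ei i) F) (x, t)

theorem contS {G : R3 × ℝ → ℝ} (hG : Continuous G) (t : ℝ) : Continuous fun x => G (x, t) :=
  hG.comp (by fun_prop)

theorem Sol.energy {Ω : Set R3} (hΩopen : IsOpen Ω) (hΩbdd : Bornology.IsBounded Ω)
    {F : R3 × ℝ → ℝ} (hF : Sol Ω F) (t : ℝ) : En Ω F t = En Ω F 0 := by
  have h1 : ContDiff ℝ 1 F := hF.reg.of_le (by norm_num)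
  have hc1 := fun w => PD_c1 hF.reg w
  have sq : ∀ w, ContDiff ℝ 1 (fun p => (PD w F p)^2) := fun w => (hc1 w).pow 2
  have psq : ∀ w p, PD tau (fun p => (PD w F p)^2) p = 2 * (PD w F p * PD tau (PD w F) p) := by
    intro w p
    have := PD_mul (hc1 w) (hc1 w) tau p
    simp only [pow_two]
    rw [this]; ring
  have hd : ∀ t, HasDerivAt (En Ω F) 0 t := by
    intro t
    have hD := (deriv_int hΩopen hΩbdd (sq tau) t).add
      (HasDerivAt.fun_sum (u := Finset.univ) fun i _ => deriv_int hΩopen hΩbdd (sq (ei i)) t)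
    refine hD.congr_deriv ?_
    have cc : ∀ v w, Continuous fun x => PD v (PD w F) (x, t) := fun v w => contS (PD_cont (hc1 w) v) t
    have c1 : ∀ w, Continuous fun x => PD w F (x, t) := fun w => contS (hc1 w).continuous t
    have dv : ∀ i, ∫ x in Ω, (PD tau F (x,t) * PD (ei i) (PD (ei i) F) (x,t)
        + PD (ei i) F (x,t) * PD tau (PD (ei i) F) (x,t)) = 0 := by
      intro i
      have hp := (hc1 tau).mul (hc1 (ei i))
      have := div_lemma Ω hΩopen hΩbdd (fun x => PD tau F (x,t) * PD (ei i) F (x,t))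
        (slice_contDiff hp t) (fun x hx => by
          have h0 : HasDerivAt (fun s => F (x, s)) 0 t := by
            simp_rw [hF.bc x hx]; exact hasDerivAt_const _ _
          rw [(PD_hasDeriv_t h1 x t).unique h0, zero_mul]) (sdir i)
      rw [← this]
      refine setIntegral_congr_fun hΩopen.measurableSet fun x hx => ?_
      try dsimp only
      rw [PD_slice (F := fun p => PD tau F p * PD (ei i) F p) hp]
      have := PD_mul (hc1 tau) (hc1 (ei i)) (ei i) (x, t)
      change _ = PD (ei i) _ _
      rw [this, PD_symm hF.reg tau (ei i)]
    simp_rw [psq]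
    rw [← integral_finsetSum _ (fun i _ => intOn hΩbdd (by fun_prop)), ← integral_add
      (intOn hΩbdd (by fun_prop)) (intOn hΩbdd (by fun_prop))]
    have := Finset.sum_eq_zero (s := (Finset.univ : Finset (Fin 3))) fun i _ => dv i
    rw [← integral_finsetSum _ (fun i _ => intOn hΩbdd (by fun_prop))] at this
    have t2 : ∀ a : ℝ, a = 0 → 2 * a = 0 := fun a h => by rw [h, mul_zero]
    have := t2 _ this
    rw [← integral_const_mul] at this
    rw [← this]
    refine setIntegral_congr_fun hΩopen.measurableSet fun x hx => ?_
    try dsimp only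
    rw [hF.pde x hx t]
    simp only [Fin.sum_univ_three]
    ring
  exact is_const_of_deriv_eq_zero (fun t => (hd t).differentiableAt) (fun t => (hd t).deriv) t 0

theorem En_nonneg_parts {Ω : Set R3} {F : R3 × ℝ → ℝ} {t : ℝ} :
    (∫ x in Ω, (PD tau F (x, t))^2) ≤ En Ω F t ∧ (∫ x in Ω, (PD (ei 0) F (x, t))^2) ≤ En Ω F t := by
  have h : ∀ w, 0 ≤ ∫ x in Ω, (PD w F (x, t))^2 := fun w => integral_nonneg fun x => sq_nonneg _
  unfold En
  rw [Fin.sum_univ_three]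
  have := h tau; have := h (ei 0); have := h (ei 1); have := h (ei 2)
  constructor <;> linarith

theorem poincare {Ω : Set R3} (hΩopen : IsOpen Ω) (hΩbdd : Bornology.IsBounded Ω)
    {F : R3 × ℝ → ℝ} (hF : Sol Ω F) :
    ∃ C, ∀ t, ∫ x in Ω, (F (x, t))^2 ≤ C := by
  obtain ⟨R, hR⟩ := hΩbdd.subset_closedBall (0 : R3)
  have h1 : ContDiff ℝ 1 F := hF.reg.of_le (by norm_num)
  refine ⟨4 * R^2 * En Ω F 0, fun t => ?_⟩
  have hc : Continuous fun x => F (x, t) := contS h1.continuous t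
  have hc0 : Continuous fun x => PD (ei 0) F (x, t) := contS (PD_cont h1 _) t
  have hs := slice_contDiff h1 t
  have hx0 : ContDiff ℝ 1 (fun x : R3 => x 0) := by fun_prop
  have hd := div_lemma Ω hΩopen hΩbdd (fun x => x 0 * (F (x, t) * F (x, t)))
    (hx0.mul (hs.mul hs)) (fun x hx => by simp [hF.bc x hx t]) (sdir 0)
  have hfd : ∀ x, fderiv ℝ (fun x : R3 => x 0 * (F (x, t) * F (x, t))) x (sdir 0)
      = F (x,t)^2 + 2 * (x 0 * F (x,t) * PD (ei 0) F (x,t)) := by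
    intro x
    have ds := hs.differentiable one_ne_zero x
    have dx := hx0.differentiable one_ne_zero x
    rw [fderiv_fun_mul dx (ds.fun_mul ds)]
    have e1 : fderiv ℝ (fun x : R3 => x 0) x (sdir 0) = 1 := by
      have : (fun x : R3 => x 0) = (EuclideanSpace.proj 0 : R3 →L[ℝ] ℝ) := rfl
      rw [this, ContinuousLinearMap.fderiv]
      simp [sdir]
    have e2 : fderiv ℝ (fun y => F (y, t)) x (sdir 0) = PD (ei 0) F (x,t) := PD_slice h1 x _ t
    have e3 := fderiv_fun_mul ds ds
    simp only [add_apply, smul_apply, e3, smul_eq_mul, e1, e2]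
    ring
  simp_rw [hfd] at hd
  have hmono : ∫ x in Ω, (1/2 * F (x,t)^2 - 2 * R^2 * (PD (ei 0) F (x,t))^2)
      ≤ ∫ x in Ω, (F (x,t)^2 + 2 * (x 0 * F (x,t) * PD (ei 0) F (x,t))) := by
    refine setIntegral_mono_on (intOn hΩbdd (by fun_prop)) (intOn hΩbdd (by fun_prop))
      hΩopen.measurableSet fun x hx => ?_
    have hn : ‖x‖ ≤ R := by simpa using hR hx
    have hxi : |x 0| ≤ R := (PiLp.norm_apply_le x 0).trans hn
    have hx2 : (x 0)^2 ≤ R^2 := sq_le_sq' (by linarith [neg_abs_le (x 0)]) (le_trans (le_abs_self _) hxi)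
    have := mul_le_mul_of_nonneg_right hx2 (sq_nonneg (PD (ei 0) F (x,t)))
    nlinarith [sq_nonneg (F (x,t) + 2 * (x 0 * PD (ei 0) F (x,t)))]
  rw [hd, integral_sub (intOn hΩbdd (by fun_prop)) (intOn hΩbdd (by fun_prop)),
    integral_const_mul, integral_const_mul] at hmono
  have h3 := (En_nonneg_parts (Ω := Ω) (F := F) (t := t)).2
  rw [hF.energy hΩopen hΩbdd t] at h3
  have := mul_le_mul_of_nonneg_left h3 (by positivity : 0 ≤ 4 * R^2)
  linarith

/-- difference quotient in time -/
def DQ (δ : ℝ) (F : R3 × ℝ → ℝ) (p : R3 × ℝ) : ℝ := (F (p + δ • tau) - F p) * δ⁻¹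

theorem add_tau (x : R3) (t δ : ℝ) : (x, t) + δ • tau = (x, t + δ) := by
  simp [tau]

theorem PD_DQ {F : R3 × ℝ → ℝ} (hF : ContDiff ℝ 1 F) (δ : ℝ) (w : R3 × ℝ) :
    PD w (DQ δ F) = DQ δ (PD w F) := by
  funext p
  have hd := hF.differentiable one_ne_zero
  have h2 : DifferentiableAt ℝ (fun p => F (p + δ • tau)) p := by fun_prop
  unfold PD DQ
  rw [fderiv_mul_const (h2.fun_sub (hd p)), fderiv_fun_sub h2 (hd p), fderiv_comp_add_right]
  simp [mul_comm]

theorem DQ_contDiff {n : WithTop ℕ∞} {F : R3 × ℝ → ℝ} (hF : ContDiff ℝ n F) (δ : ℝ) :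
    ContDiff ℝ n (DQ δ F) := by
  unfold DQ
  fun_prop

theorem Sol.dq {Ω : Set R3} {F : R3 × ℝ → ℝ} (hF : Sol Ω F) (δ : ℝ) : Sol Ω (DQ δ F) where
  reg := DQ_contDiff hF.reg δ
  bc := fun x hx t => by simp [DQ, add_tau, hF.bc x hx]
  pde := fun x hx t => by
    have h1 : ContDiff ℝ 1 F := hF.reg.of_le (by norm_num)
    simp only [PD_DQ h1, PD_DQ (PD_c1 hF.reg _)]
    simp only [DQ, add_tau, hF.pde x hx]
    simp only [Fin.sum_univ_three]
    ring

theorem DQ_lim {Ω : Set R3} (hΩopen : IsOpen Ω) (hΩbdd : Bornology.IsBounded Ω)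
    {G : R3 × ℝ → ℝ} (hG : ContDiff ℝ 1 G) (t : ℝ) :
    Filter.Tendsto (fun δ => ∫ x in Ω, (DQ δ G (x, t))^2) (nhdsWithin 0 {0}ᶜ)
      (nhds (∫ x in Ω, (PD tau G (x, t))^2)) := by
  obtain ⟨C, hC⟩ := bddBox hΩbdd (PD_cont hG tau) t
  refine tendsto_integral_filter_of_dominated_convergence (fun _ => C^2) ?_ ?_ ?_ ?_
  · exact Filter.Eventually.of_forall fun δ =>
      ((contS (DQ_contDiff hG δ).continuous t).pow 2).aestronglyMeasurable
  · have : Icc (-1:ℝ) 1 ∈ nhdsWithin (0:ℝ) {0}ᶜ :=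
      mem_nhdsWithin_of_mem_nhds (Icc_mem_nhds (by norm_num) (by norm_num))
    filter_upwards [this, self_mem_nhdsWithin] with δ hδ hδ0
    refine (ae_restrict_mem hΩopen.measurableSet).mono fun x hx => ?_
    have hm := Convex.norm_image_sub_le_of_norm_hasDerivWithin_le (s := Icc (t-1) (t+1))
      (x := t) (y := t + δ)
      (fun s _ => (PD_hasDeriv_t hG x s).hasDerivWithinAt) (fun s hs => hC x hx s hs)
      (convex_Icc _ _) ⟨by linarith, by linarith⟩ ⟨by linarith [hδ.1], by linarith [hδ.2]⟩
    have hδp : 0 < |δ| := abs_pos.2 hδ0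
    have : |DQ δ G (x,t)| ≤ C := by
      rw [DQ, add_tau, abs_mul, abs_inv, ← div_eq_mul_inv, div_le_iff₀ hδp]
      simpa using hm
    rw [norm_pow, Real.norm_eq_abs]
    exact pow_le_pow_left₀ (abs_nonneg _) this 2
  · exact integrableOn_const hΩbdd.measure_lt_top.ne
  · refine Filter.Eventually.of_forall fun x => ?_
    refine Filter.Tendsto.pow ?_ 2
    have := (PD_hasDeriv_t hG x t).tendsto_slope_zero
    refine this.congr fun δ => ?_
    rw [DQ, add_tau, smul_eq_mul, mul_comm]

theorem Sol.utt {Ω : Set R3} (hΩopen : IsOpen Ω) (hΩbdd : Bornology.IsBounded Ω)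
    {F : R3 × ℝ → ℝ} (hF : Sol Ω F) :
    ∃ C, ∀ t, ∫ x in Ω, (PD tau (PD tau F) (x, t))^2 ≤ C := by
  have h1 : ContDiff ℝ 1 F := hF.reg.of_le (by norm_num)
  let E2 : ℝ → ℝ := fun t => (∫ x in Ω, (PD tau (PD tau F) (x, t))^2)
    + ∑ i : Fin 3, ∫ x in Ω, (PD tau (PD (ei i) F) (x, t))^2
  have hl : ∀ t, Filter.Tendsto (fun δ => En Ω (DQ δ F) t) (nhdsWithin 0 {0}ᶜ) (nhds (E2 t)) := by
    intro t
    unfold En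
    simp_rw [PD_DQ h1]
    exact (DQ_lim hΩopen hΩbdd (PD_c1 hF.reg _) t).add
      (tendsto_finsetSum _ fun i _ => DQ_lim hΩopen hΩbdd (PD_c1 hF.reg _) t)
  refine ⟨E2 0, fun t => ?_⟩
  have : E2 t = E2 0 := by
    refine tendsto_nhds_unique (hl t) ?_
    simp_rw [fun δ => (hF.dq δ).energy hΩopen hΩbdd t]
    exact hl 0
  rw [← this]
  exact le_add_of_nonneg_right (Finset.sum_nonneg fun i _ => integral_nonneg fun x => sq_nonneg _)

theorem prodInt {Ω : Set R3} (hΩbdd : Bornology.IsBounded Ω)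
    {G : R3 × ℝ → ℝ} (hG : Continuous G) (hC : ∃ C, ∀ t, ∫ x in Ω, (G (x, t))^2 ≤ C) :
    Integrable (fun p : R3 × ℝ => Real.exp (-p.2^2/4) * (G p)^2)
      ((volume.restrict Ω).prod volume) := by
  obtain ⟨C, hC⟩ := hC
  have hcont : Continuous (fun p : R3 × ℝ => Real.exp (-p.2^2/4) * (G p)^2) := by fun_prop
  rw [integrable_prod_iff' hcont.aestronglyMeasurable]
  constructor
  · refine Filter.Eventually.of_forall fun t => ?_
    exact intOn hΩbdd (contS hcont t)
  · have hg : Integrable (fun t : ℝ => Real.exp (-t^2/4) * C) := by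
      have := (integrable_exp_neg_mul_sq (b := 1/4) (by norm_num)).mul_const C
      refine this.congr (Filter.Eventually.of_forall fun t => ?_)
      dsimp only
      congr 2; ring
    refine hg.mono' ?_ ?_
    · exact (hcont.norm.aestronglyMeasurable (μ := (volume.restrict Ω).prod volume)).prod_swap.integral_prod_right'
    · refine Filter.Eventually.of_forall fun t => ?_
      have e : ∀ x, ‖Real.exp (-t^2/4) * (G (x,t))^2‖ = Real.exp (-t^2/4) * (G (x,t))^2 := fun x =>
        Real.norm_of_nonneg (by positivity)
      simp_rw [e]
      rw [integral_const_mul, Real.norm_of_nonneg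
        (mul_nonneg (Real.exp_pos _).le (integral_nonneg fun x => sq_nonneg _))]
      exact mul_le_mul_of_nonneg_left (hC t) (Real.exp_pos _).le

theorem exp_facts (t : ℝ) : (Real.exp (-t^2/4))^2 ≤ Real.exp (-t^2/4) ∧
    t^2 * (Real.exp (-t^2/4))^2 ≤ 4 * Real.exp (-t^2/4) ∧
    |t| * (Real.exp (-t^2/4))^2 ≤ Real.exp (-t^2/4) := by
  set e := Real.exp (-t^2/4) with he
  have hp : 0 < e := Real.exp_pos _
  have h1 : (1 + t^2/4) * e ≤ 1 := by
    have h2 : t^2/4 + 1 ≤ Real.exp (t^2/4) := Real.add_one_le_exp _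
    have h3 : Real.exp (t^2/4) * e = 1 := by rw [he, ← Real.exp_add]; ring_nf; exact Real.exp_zero
    nlinarith
  have hab : |t| ≤ 1 + t^2/4 := by nlinarith [sq_abs t, sq_nonneg (|t| - 2)]
  have k1 : (1 + t^2/4) * e * e ≤ 1 * e := mul_le_mul_of_nonneg_right h1 hp.le
  have k2 : |t| * (e * e) ≤ (1 + t^2/4) * (e * e) := mul_le_mul_of_nonneg_right hab (by positivity)
  have k3 : 0 ≤ t^2 * (e*e) := by positivity
  refine ⟨?_, ?_, ?_⟩ <;> nlinarith [mul_pos hp hp]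

theorem oneD {u v w : ℝ → ℝ} (huv : ∀ t, HasDerivAt u (v t) t) (hvw : ∀ t, HasDerivAt v (w t) t)
    (hw : Continuous w)
    (I0 : Integrable fun t => Real.exp (-t^2/4) * (u t)^2)
    (I1 : Integrable fun t => Real.exp (-t^2/4) * (v t)^2)
    (I2 : Integrable fun t => Real.exp (-t^2/4) * (w t)^2) :
    ∫ t, (Real.exp (-t^2/4))^2 * (v t)^2 ≤
      2 * (∫ t, Real.exp (-t^2/4) * (u t)^2) - ∫ t, (Real.exp (-t^2/4))^2 * (w t * u t) := by
  have cu : Continuous u := continuous_iff_continuousAt.2 fun t => (huv t).continuousAt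
  have cv : Continuous v := continuous_iff_continuousAt.2 fun t => (hvw t).continuousAt
  have J1 : Integrable fun t => (Real.exp (-t^2/4))^2 * (v t)^2 := by
    refine I1.mono' (by fun_prop) (Filter.Eventually.of_forall fun t => ?_)
    rw [Real.norm_of_nonneg (by positivity)]
    exact mul_le_mul_of_nonneg_right (exp_facts t).1 (sq_nonneg _)
  have J2 : Integrable fun t => (Real.exp (-t^2/4))^2 * (w t * u t) := by
    refine (I0.add I2).mono' (by fun_prop) (Filter.Eventually.of_forall fun t => ?_)
    rw [norm_mul, Real.norm_of_nonneg (by positivity : 0 ≤ (Real.exp (-t^2/4))^2)]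
    have a : |w t * u t| ≤ (u t)^2 + (w t)^2 := by
      rw [abs_le]; constructor <;> nlinarith [sq_nonneg (w t + u t), sq_nonneg (w t - u t)]
    have := mul_le_mul (exp_facts t).1 a (abs_nonneg _) (Real.exp_pos _).le
    simp only [Pi.add_apply, Real.norm_eq_abs]
    linarith
  have J3 : Integrable fun t => (Real.exp (-t^2/4))^2 * (1/2 * (1 - t^2) * (u t)^2) := by
    refine (I0.const_mul 3).mono' (by fun_prop) (Filter.Eventually.of_forall fun t => ?_)
    obtain ⟨f1, f2, f3⟩ := exp_facts t
    have := mul_le_mul_of_nonneg_right f1 (sq_nonneg (u t))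
    have := mul_le_mul_of_nonneg_right f2 (sq_nonneg (u t))
    have : 0 ≤ Real.exp (-t^2/4)^2 * (u t)^2 := by positivity
    have : 0 ≤ t^2 * Real.exp (-t^2/4)^2 * (u t)^2 := by positivity
    rw [Real.norm_eq_abs, abs_le]
    constructor <;> nlinarith
  have J4 : Integrable fun t => (Real.exp (-t^2/4))^2 * (u t * v t + 1/2 * t * (u t)^2) := by
    refine ((I0.const_mul 2).add I1).mono' (by fun_prop) (Filter.Eventually.of_forall fun t => ?_)
    obtain ⟨f1, f2, f3⟩ := exp_facts t
    set e := Real.exp (-t^2/4)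
    have m1 := mul_le_mul_of_nonneg_right f1 (sq_nonneg (u t))
    have m2 := mul_le_mul_of_nonneg_right f1 (sq_nonneg (v t))
    have m3 := mul_le_mul_of_nonneg_right f3 (sq_nonneg (u t))
    have a : |u t * v t| ≤ (u t)^2 + (v t)^2 := by
      rw [abs_le]; constructor <;> nlinarith [sq_nonneg (v t + u t), sq_nonneg (v t - u t)]
    have m4 := mul_le_mul_of_nonneg_left a (sq_nonneg e)
    have m5 : |u t * v t + 1/2 * t * (u t)^2| ≤ |u t * v t| + 1/2 * |t| * (u t)^2 := by
      refine (abs_add_le _ _).trans ?_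
      rw [abs_mul (1/2 * t), abs_mul (1/2 : ℝ), abs_of_nonneg (sq_nonneg (u t)),
        abs_of_nonneg (by norm_num : (0:ℝ) ≤ 1/2)]
    have m6 := mul_le_mul_of_nonneg_left m5 (sq_nonneg e)
    have m7 : 0 ≤ |t| * e^2 * (u t)^2 := by positivity
    rw [norm_mul, Real.norm_of_nonneg (sq_nonneg e), Real.norm_eq_abs]
    simp only [Pi.add_apply]
    nlinarith
  have he : ∀ t : ℝ, HasDerivAt (fun t => Real.exp (-t^2/4)) (Real.exp (-t^2/4) * (-(t/2))) t := by
    intro t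
    have : HasDerivAt (fun t : ℝ => -t^2/4) (-(t/2)) t := by
      refine (((hasDerivAt_pow 2 t).fun_neg).div_const 4).congr_deriv ?_
      simp; ring
    exact this.exp
  have hz := integral_eq_zero_of_hasDerivAt_of_integrable (f' := fun t =>
      (Real.exp (-t^2/4))^2 * (v t)^2 + (Real.exp (-t^2/4))^2 * (w t * u t)
        + (Real.exp (-t^2/4))^2 * (1/2 * (1 - t^2) * (u t)^2)) (fun t => by
      refine (((he t).fun_pow 2).fun_mul (((huv t).fun_mul (hvw t)).fun_add
        (((hasDerivAt_id' t).const_mul (1/2 : ℝ)).fun_mul ((huv t).fun_pow 2)))).congr_deriv ?_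
      simp; ring) ((J1.add J2).add J3) J4
  rw [integral_add (J1.fun_add J2) J3, integral_add J1 J2] at hz
  have hm : ∫ t, (Real.exp (-t^2/4))^2 * (1/2 * (1 - t^2) * (u t)^2) ≥
      ∫ t, (-2) * (Real.exp (-t^2/4) * (u t)^2) := by
    refine integral_mono (I0.const_mul _) J3 fun t => ?_
    obtain ⟨f1, f2, f3⟩ := exp_facts t
    have := mul_le_mul_of_nonneg_right f2 (sq_nonneg (u t))
    have : 0 ≤ Real.exp (-t^2/4)^2 * (u t)^2 := by positivity
    dsimp only
    nlinarith
  rw [integral_const_mul] at hm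
  linarith

theorem main_aux {Ω : Set R3} (hΩopen : IsOpen Ω) (hΩbdd : Bornology.IsBounded Ω)
    {U : R3 × ℝ → ℝ} (hU : Sol Ω U) (c : R3 → ℝ) (hc : Continuous c)
    (hc01 : ∀ x, 0 ≤ c x ∧ c x ≤ 1) :
    (∫ x in Ω, ∫ t : ℝ, c x * ((Real.exp (-t^2/4))^2 * (PD tau U (x,t))^2)) ≤
      2 * (∫ x in Ω, ∫ t : ℝ, c x * (Real.exp (-t^2/4) * (U (x,t))^2)) +
      |∫ x in Ω, ∫ t : ℝ, c x * ((Real.exp (-t^2/4))^2 *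
        (PD tau (PD tau U) (x,t) * U (x,t)))| := by
  have h1 : ContDiff ℝ 1 U := hU.reg.of_le (by norm_num)
  have hc1 := PD_c1 hU.reg tau
  have k0 : Continuous U := h1.continuous
  have k1 : Continuous (PD tau U) := hc1.continuous
  have k2 : Continuous (PD tau (PD tau U)) := PD_cont hc1 tau
  have I0 := prodInt hΩbdd k0 (poincare hΩopen hΩbdd hU)
  have I1 := prodInt hΩbdd k1
    ⟨En Ω U 0, fun t => by rw [← hU.energy hΩopen hΩbdd t]; exact En_nonneg_parts.1⟩
  have I2 := prodInt hΩbdd k2 (hU.utt hΩopen hΩbdd)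
  have T1 : Integrable (fun p : R3 × ℝ => c p.1 * ((Real.exp (-p.2^2/4))^2 * (PD tau U p)^2))
      ((volume.restrict Ω).prod volume) := by
    refine I1.mono' (Continuous.aestronglyMeasurable (by fun_prop)) (Filter.Eventually.of_forall fun p => ?_)
    have hp := hc01 p.1
    rw [Real.norm_of_nonneg (mul_nonneg hp.1 (by positivity))]
    have a := mul_le_mul_of_nonneg_right (exp_facts p.2).1 (sq_nonneg (PD tau U p))
    exact (mul_le_of_le_one_left (by positivity) hp.2).trans a
  have T2 : Integrable (fun p : R3 × ℝ => c p.1 * (Real.exp (-p.2^2/4) * (U p)^2))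
      ((volume.restrict Ω).prod volume) := by
    refine I0.mono' (Continuous.aestronglyMeasurable (by fun_prop)) (Filter.Eventually.of_forall fun p => ?_)
    have hp := hc01 p.1
    rw [Real.norm_of_nonneg (mul_nonneg hp.1 (by positivity))]
    exact (mul_le_of_le_one_left (by positivity) hp.2)
  have T3 : Integrable (fun p : R3 × ℝ => c p.1 * ((Real.exp (-p.2^2/4))^2 *
        (PD tau (PD tau U) p * U p)))
      ((volume.restrict Ω).prod volume) := by
    refine (I0.add I2).mono' (Continuous.aestronglyMeasurable (by fun_prop)) (Filter.Eventually.of_forall fun p => ?_)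
    have hp := hc01 p.1
    rw [norm_mul, Real.norm_of_nonneg hp.1]
    refine (mul_le_of_le_one_left (norm_nonneg _) hp.2).trans ?_
    rw [norm_mul, Real.norm_of_nonneg (by positivity : 0 ≤ (Real.exp (-p.2^2/4))^2)]
    have a : |PD tau (PD tau U) p * U p| ≤ (U p)^2 + (PD tau (PD tau U) p)^2 := by
      rw [abs_le]
      constructor <;> nlinarith [sq_nonneg (PD tau (PD tau U) p + U p),
        sq_nonneg (PD tau (PD tau U) p - U p)]
    have := mul_le_mul (exp_facts p.2).1 a (abs_nonneg _) (Real.exp_pos _).le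
    simp only [Pi.add_apply, Real.norm_eq_abs]
    linarith
  have S1 := T1.integral_prod_left
  have S2 := T2.integral_prod_left
  have S3 := T3.integral_prod_left
  dsimp only at S1 S2 S3
  have hm : (∫ x in Ω, ∫ t : ℝ, c x * ((Real.exp (-t^2/4))^2 * (PD tau U (x,t))^2)) ≤
      ∫ x in Ω, (2 * (∫ t : ℝ, c x * (Real.exp (-t^2/4) * (U (x,t))^2)) -
        ∫ t : ℝ, c x * ((Real.exp (-t^2/4))^2 * (PD tau (PD tau U) (x,t) * U (x,t)))) := by
    refine integral_mono_ae S1 ((S2.const_mul 2).sub S3) ?_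
    filter_upwards [I0.prod_right_ae, I1.prod_right_ae, I2.prod_right_ae] with x a0 a1 a2
    have := oneD (fun t => PD_hasDeriv_t h1 x t) (fun t => PD_hasDeriv_t hc1 x t)
      (k2.comp (by fun_prop : Continuous fun t : ℝ => (x, t))) a0 a1 a2
    simp only [integral_const_mul]
    have := mul_le_mul_of_nonneg_left this (hc01 x).1
    linarith
  rw [integral_sub (S2.const_mul 2) S3, integral_const_mul] at hm
  have := neg_abs_le (∫ x in Ω, ∫ t : ℝ, c x * ((Real.exp (-t^2/4))^2 *
        (PD tau (PD tau U) (x,t) * U (x,t))))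
  linarith


/-- **Inequality (2.2).**
`∫_{Ω×ℝ} χ(x)|a_o ∂_t u|² ≤ 2∫_{Ω×ℝ} a_o(x,t/√2) φ(x,t/√2)|u|²
  + |∫_{Ω×ℝ} a_o φ ∂_t²u · u|`, where `φ(x,t) = χ(x) a_o(x,t)`. -/
theorem localized_energy_inequality
    (m₁ m₂ ρ : ℝ) (hm₁ : 0 < m₁) (hm₂ : 0 < m₂) (hρ : 0 < ρ)
    (Ω : Set R3) (hΩopen : IsOpen Ω) (hΩconn : IsConnected Ω)
    (hΩbdd : Bornology.IsBounded Ω)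
    (Υ : Set R3)
    (hΥ : Υ ⊆ {x : R3 | ¬ (x 0 ∈ Ioo (-m₁) m₁ ∧ x 1 ∈ Ioo (-m₂) m₂)})
    (hbd : frontier Ω =
      {x : R3 | x 0 ∈ Icc (-m₁) m₁ ∧ x 1 ∈ Icc (-m₂) m₂ ∧ x 2 = ρ} ∪
      {x : R3 | x 0 ∈ Icc (-m₁) m₁ ∧ x 1 ∈ Icc (-m₂) m₂ ∧ x 2 = -ρ} ∪ Υ)
    (r_o : ℝ) (hr₁ : 0 < r_o) (hr₂ : r_o < min (min m₁ m₂) ρ / 2)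
    (x_o : R3)
    (hx_o : x_o ∈ closure {x : R3 | x 0 ∈ Ioo (-m₁+r_o) (m₁-r_o) ∧
      x 1 ∈ Ioo (-m₂+r_o) (m₂-r_o) ∧ x 2 ∈ Ioo (-(ρ/4)) (ρ/4)})
    (h : ℝ) (hh : h ∈ Ioc (0:ℝ) (min 1 ((r_o/8)^2)))
    (χ : R3 → ℝ) (hχsm : ContDiff ℝ (⊤ : ℕ∞) χ)
    (hχsupp : tsupport χ ⊆ Metric.ball x_o (r_o/2))
    (hχ01 : ∀ x, 0 ≤ χ x ∧ χ x ≤ 1)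
    (hχ1 : ∀ x ∈ Metric.ball x_o (r_o/4), χ x = 1)
    (u : R3 → ℝ → ℝ) (u₀ u₁ : R3 → ℝ)
    (hreg : ContDiff ℝ 2 (Function.uncurry u))
    (hpde : ∀ x ∈ Ω, ∀ t : ℝ, deriv (deriv (u x)) t = lapR (fun y => u y t) x)
    (hbc : ∀ x ∈ frontier Ω, ∀ t : ℝ, u x t = 0)
    (hic0 : ∀ x, u x 0 = u₀ x) (hic1 : ∀ x, deriv (u x) 0 = u₁ x)
    (hu₀bc : ∀ x ∈ frontier Ω, u₀ x = 0) (hu₁bc : ∀ x ∈ frontier Ω, u₁ x = 0) :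
    (∫ x in Ω, ∫ t : ℝ, χ x * (aO h x_o x t * deriv (u x) t) ^ 2) ≤
      2 * (∫ x in Ω, ∫ t : ℝ,
        aO h x_o x (t / Real.sqrt 2) * (χ x * aO h x_o x (t / Real.sqrt 2)) *
          (u x t) ^ 2) +
      |∫ x in Ω, ∫ t : ℝ,
        aO h x_o x t * (χ x * aO h x_o x t) * (deriv (deriv (u x)) t * u x t)| := by
  have h1 : ContDiff ℝ 1 (Function.uncurry u) := hreg.of_le (by norm_num)
  have d1 : ∀ x, deriv (u x) = fun t => PD tau (Function.uncurry u) (x, t) := fun x =>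
    funext fun t => (PD_hasDeriv_t h1 x t).deriv
  have d2 : ∀ x t, deriv (deriv (u x)) t = PD tau (PD tau (Function.uncurry u)) (x, t) := by
    intro x t
    rw [d1]
    exact (PD_hasDeriv_t (PD_c1 hreg tau) x t).deriv
  have hsol : Sol Ω (Function.uncurry u) := by
    refine ⟨hreg, fun x hx t => hbc x hx t, fun x hx t => ?_⟩
    rw [← d2, hpde x hx t]
    unfold lapR
    refine Finset.sum_congr rfl fun i _ => ?_
    have e : (fun y => lineDeriv ℝ (fun y => u y t) y (sdir i))
        = fun y => PD (ei i) (Function.uncurry u) (y, t) :=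
      funext fun y => PD_line h1 y (sdir i) t
    rw [e]
    exact PD_line (PD_c1 hreg (ei i)) x (sdir i) t
  have hh0 : 0 < h := hh.1
  have := main_aux hΩopen hΩbdd hsol
    (fun x => χ x * (Real.exp (-‖x - x_o‖^2 / (4*h)))^2)
    (hχsm.continuous.mul (by fun_prop)) (fun x => by
      have hp := hχ01 x
      refine ⟨mul_nonneg hp.1 (sq_nonneg _), ?_⟩
      refine mul_le_one₀ hp.2 (sq_nonneg _) (pow_le_one₀ (Real.exp_pos _).le ?_)
      rw [Real.exp_le_one_iff]
      exact div_nonpos_of_nonpos_of_nonneg (by simp) (by positivity))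
  have e8 : ∀ t : ℝ, Real.exp (-(t / Real.sqrt 2)^2 / 4) * Real.exp (-(t / Real.sqrt 2)^2 / 4)
      = Real.exp (-t^2/4) := by
    intro t
    rw [← Real.exp_add, div_pow, Real.sq_sqrt (by norm_num)]
    congr 1; ring
  simp only [d2]
  simp only [d1]
  convert this using 1
  · refine integral_congr_ae (Filter.Eventually.of_forall fun x => integral_congr_ae
      (Filter.Eventually.of_forall fun t => ?_))
    simp only [aO]; ring
  · congr 2
    · refine integral_congr_ae (Filter.Eventually.of_forall fun x => integral_congr_ae
        (Filter.Eventually.of_forall fun t => ?_))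
      simp only [aO, ← e8 t, Function.uncurry]; ring
    · refine integral_congr_ae (Filter.Eventually.of_forall fun x => integral_congr_ae
        (Filter.Eventually.of_forall fun t => ?_))
      simp only [aO, Function.uncurry]; ring
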